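/- Let E ⊂ Q̄_p be a pseudo-convergent sequence of transcendental type. Then there exists a strongly stacked sequence E' ⊂ Q̄_p which is equivalent to E (so that ℤ_{p,E} = ℤ_{p,E'}). In particular, for every residually algebraic torsion extension W of ℤ_p to ℚ_p(X) there exists a strongly stacked sequence E' ⊂ Q̄_p such that W = ℤ_{p,E'}. -/

import Mathlib

open Polynomial Filter

noncomputable section

/-- An additive `ℚ`-valued valuation on a field `K` (written additively, with `v 0 = ⊤`). -/
structure AddVal (K : Type) [Field K] where
  v : K → WithTop ℚ
  v_eq_top_iff : ∀ x : K, v x = ⊤ ↔ x = 0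
  v_mul : ∀ x y : K, v (x * y) = v x + v y
  min_le_v_add : ∀ x y : K, min (v x) (v y) ≤ v (x + y)

namespace AddVal

variable {K : Type} [Field K] (w : AddVal K)

/-- A Cauchy sequence with respect to an additive valuation. -/
def IsCauchySeq (s : ℕ → K) : Prop :=
  ∀ γ : ℚ, ∃ N : ℕ, ∀ m ≥ N, ∀ n ≥ N, (γ : WithTop ℚ) < w.v (s m - s n)

/-- Convergence of a sequence to a limit, with respect to an additive valuation. -/
def TendsToVal (s : ℕ → K) (l : K) : Prop :=
  ∀ γ : ℚ, ∃ N : ℕ, ∀ n ≥ N, (γ : WithTop ℚ) < w.v (s n - l)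

/-- A pseudo-convergent sequence: `v (s n - s m) < v (s m - s k)` for `n < m < k`. -/
def IsPseudoConvergent (s : ℕ → K) : Prop :=
  ∀ ⦃n m k : ℕ⦄, n < m → m < k → w.v (s n - s m) < w.v (s m - s k)

/-- A sequence is of transcendental type over a subring (mapped in via `g`) if for every
polynomial `f` over that ring the sequence `v (f (s n))` is eventually constant. -/
def IsTranscendentalTypeOver {R : Type} [CommRing R] (g : R →+* K) (s : ℕ → K) : Prop :=
  ∀ f : Polynomial R, ∃ N : ℕ, ∀ m ≥ N, ∀ n ≥ N,
    w.v (f.eval₂ g (s m)) = w.v (f.eval₂ g (s n))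

/-- A sequence of transcendental type: for every polynomial `f ∈ K[X]`, `v (f (s n))` is
eventually constant. -/
def IsTranscendentalType (s : ℕ → K) : Prop :=
  w.IsTranscendentalTypeOver (RingHom.id K) s

/-- `α` is a pseudo-limit of `s` when `v (s n - α)` is strictly increasing. -/
def IsPseudoLimit (s : ℕ → K) (α : K) : Prop :=
  StrictMono fun n => w.v (s n - α)

/-- The breadth ideal of a pseudo-convergent sequence. -/
def breadth (s : ℕ → K) : Set K :=
  {x : K | ∀ n : ℕ, w.v (s (n + 1) - s n) < w.v x}

/-- Equivalence of pseudo-convergent sequences. -/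
def SeqEquiv (s t : ℕ → K) : Prop :=
  w.breadth s = w.breadth t ∧
    ∀ k : ℕ, ∃ i₀ j₀ : ℕ, ∀ i ≥ i₀, ∀ j ≥ j₀, w.v (s (k + 1) - s k) < w.v (s i - t j)

end AddVal

/-- `α` is transcendental over the image of `g`. -/
def IsTranscOver {R K : Type} [CommRing R] [Field K] (g : R →+* K) (α : K) : Prop :=
  ∀ f : Polynomial R, f ≠ 0 → f.eval₂ g α ≠ 0
/-- A fixed algebraic closure of `ℚ_p`. -/
abbrev Qpbar (p : ℕ) [Fact p.Prime] : Type := AlgebraicClosure ℚ_[p]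

/-- The unique extension of the `p`-adic valuation to the algebraic closure of `ℚ_p`,
presented as an additive `ℚ`-valued valuation extending `Padic.valuation`. -/
structure PadicSetup (p : ℕ) [Fact p.Prime] where
  vbar : AddVal (Qpbar p)
  vbar_extends : ∀ x : ℚ_[p], x ≠ 0 →
    vbar.v (algebraMap ℚ_[p] (Qpbar p) x) = ((x.valuation : ℚ) : WithTop ℚ)

/-- A model of `ℂ_p`: a complete valued field in which `Q̄_p` embeds isometrically
and densely. -/
structure CpSetup (p : ℕ) [Fact p.Prime] extends PadicSetup p where
  Cp : Type
  [fieldCp : Field Cp]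
  emb : Qpbar p →+* Cp
  vC : AddVal Cp
  vC_emb : ∀ x : Qpbar p, vC.v (emb x) = vbar.v x
  complete : ∀ s : ℕ → Cp, vC.IsCauchySeq s → ∃ l : Cp, vC.TendsToVal s l
  dense : ∀ y : Cp, ∃ s : ℕ → Qpbar p, vC.TendsToVal (fun n => emb (s n)) y

attribute [instance] CpSetup.fieldCp

variable (p : ℕ) [Fact p.Prime]

/-- The degree `[ℚ_p(x) : ℚ_p]` of an element of the algebraic closure of `ℚ_p`. -/
def degOf (x : Qpbar p) : ℕ :=
  Module.finrank ℚ_[p] ↥(IntermediateField.adjoin ℚ_[p] {x})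

/-- A stacked sequence in `Q̄_p`: `s 0 ∈ ℚ_p`, the degrees `[ℚ_p(s n) : ℚ_p]` are strictly
increasing, and each `(s n, v (s (n+1) - s n))` is a minimal pair. -/
structure IsStacked (S : PadicSetup p) (s : ℕ → Qpbar p) : Prop where
  first : ∃ c : ℚ_[p], s 0 = algebraMap ℚ_[p] (Qpbar p) c
  deg_lt : ∀ n : ℕ, degOf p (s n) < degOf p (s (n + 1))
  min_pair : ∀ n : ℕ, ∀ c : Qpbar p, degOf p c < degOf p (s n) →
    S.vbar.v (s n - c) < S.vbar.v (s (n + 1) - s n)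

/-- A strongly stacked sequence: moreover each pair `(s n, s (n+1))` is distinguished. -/
structure IsStronglyStacked (S : PadicSetup p) (s : ℕ → Qpbar p) extends
    IsStacked p S s : Prop where
  dist : ∀ n : ℕ, ∀ c : Qpbar p, degOf p c < degOf p (s (n + 1)) →
    S.vbar.v (s (n + 1) - c) ≤ S.vbar.v (s (n + 1) - s n)

/-- The canonical map `ℚ → Q̄_p`. -/
def qHomQpbar : ℚ →+* Qpbar p :=
  (algebraMap ℚ_[p] (Qpbar p)).comp (Rat.castHom ℚ_[p])

/-- The ring `ℤ_{p,E}` (as a subset of `ℚ_p(X)`) attached to a sequence `E ⊆ Q̄_p`: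
rational functions mapping almost all the `s n` into `Z̄_p`. -/
def ZpE (S : PadicSetup p) (s : ℕ → Qpbar p) : Set (RatFunc ℚ_[p]) :=
  {φ : RatFunc ℚ_[p] | ∀ᶠ n in atTop,
    φ.denom.eval₂ (algebraMap ℚ_[p] (Qpbar p)) (s n) ≠ 0 ∧
      0 ≤ S.vbar.v (φ.eval (algebraMap ℚ_[p] (Qpbar p)) (s n))}

/-- The ring `ℤ_{(p),E}` (as a subset of `ℚ(X)`) attached to a sequence `E ⊆ Q̄_p`. -/
def ZplE (S : PadicSetup p) (s : ℕ → Qpbar p) : Set (RatFunc ℚ) :=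
  {φ : RatFunc ℚ | ∀ᶠ n in atTop,
    φ.denom.eval₂ (qHomQpbar p) (s n) ≠ 0 ∧
      0 ≤ S.vbar.v (φ.eval (qHomQpbar p) (s n))}

/-- `W` is a residually algebraic torsion extension of `ℤ_p` to `ℚ_p(X)`:
`W ∩ ℚ_p = ℤ_p`, the residue field of `W` is algebraic over `𝔽_p`, and the value group of `W`
is contained in the divisible hull of the value group of `ℤ_p`. -/
def IsResAlgTorsionQp (W : ValuationSubring (RatFunc ℚ_[p])) : Prop :=
  (∀ c : ℚ_[p], RatFunc.C c ∈ W ↔ ‖c‖ ≤ 1) ∧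
  (∀ x : IsLocalRing.ResidueField W, ∃ k : ℕ, 1 ≤ k ∧ x ^ p ^ k = x) ∧
  (∀ φ : RatFunc ℚ_[p], φ ≠ 0 → ∃ n : ℕ, 1 ≤ n ∧ ∃ c : ℚ_[p], c ≠ 0 ∧
    φ ^ n / RatFunc.C c ∈ W ∧ RatFunc.C c / φ ^ n ∈ W)

/-- `W` is a residually algebraic torsion extension of `ℤ_(p)` to `ℚ(X)`. -/
def IsResAlgTorsionQ (W : ValuationSubring (RatFunc ℚ)) : Prop :=
  (∀ c : ℚ, RatFunc.C c ∈ W ↔ ‖(c : ℚ_[p])‖ ≤ 1) ∧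
  (∀ x : IsLocalRing.ResidueField W, ∃ k : ℕ, 1 ≤ k ∧ x ^ p ^ k = x) ∧
  (∀ φ : RatFunc ℚ, φ ≠ 0 → ∃ n : ℕ, 1 ≤ n ∧ ∃ c : ℚ, c ≠ 0 ∧
    φ ^ n / RatFunc.C c ∈ W ∧ RatFunc.C c / φ ^ n ∈ W)

/-- The set of (rational) values of the valuation on an intermediate field of `Q̄_p/ℚ_p`. -/
def valSetF (S : PadicSetup p) (F : IntermediateField ℚ_[p] (Qpbar p)) : Set ℚ :=
  {γ : ℚ | ∃ a ∈ F, S.vbar.v a = (γ : WithTop ℚ)}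

/-- The value group (as a set of rationals) of `ℚ_p(x)` for `x ∈ Q̄_p`. -/
def valSetElem (S : PadicSetup p) (x : Qpbar p) : Set ℚ :=
  valSetF p S (IntermediateField.adjoin ℚ_[p] {x})

/-- The residue field of `F` is contained in the residue field of `F'` (inside the residue
field of `Z̄_p`). -/
def resSub (S : PadicSetup p) (F F' : IntermediateField ℚ_[p] (Qpbar p)) : Prop :=
  ∀ a ∈ F, 0 ≤ S.vbar.v a → ∃ b ∈ F', 0 ≤ S.vbar.v b ∧ 0 < S.vbar.v (a - b)

/-- A subset `Γ ⊆ ℚ` (a value group) has bounded denominators, i.e. finite ramification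
over `ℤ`. -/
def HasFiniteRamification (Γ : Set ℚ) : Prop :=
  ∃ e : ℕ, 0 < e ∧ ∀ γ ∈ Γ, ∃ k : ℤ, (e : ℚ) * γ = (k : ℚ)

/-- The ramification index of `Γ₁` over `Γ₀`: the least positive integer `e` with
`e • Γ₁ ⊆ Γ₀` (for the value groups of finite extensions of `ℚ_p` this is the index
`[Γ₁ : Γ₀]`). -/
def ramIdx (Γ₀ Γ₁ : Set ℚ) : ℕ :=
  sInf {e : ℕ | 0 < e ∧ ∀ γ ∈ Γ₁, (e : ℚ) * γ ∈ Γ₀}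

/-- The value group of `ℚ_p` (normalized): the integers, as a subset of `ℚ`. -/
def zSet : Set ℚ := Set.range ((↑) : ℤ → ℚ)

/-- The maximal unramified extension of a finite extension `K` of `ℚ_p` inside `Q̄_p`:
the set of `x` with `K(x)/K` unramified. -/
def maxUnramified (S : PadicSetup p) (K : IntermediateField ℚ_[p] (Qpbar p)) :
    Set (Qpbar p) :=
  {x : Qpbar p | valSetF p S (K ⊔ IntermediateField.adjoin ℚ_[p] {x}) = valSetF p S K}

section CpDefs

variable (S : CpSetup p)

/-- The canonical map `ℚ_p → ℂ_p`. -/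
def qpHomC : ℚ_[p] →+* S.Cp :=
  S.emb.comp (algebraMap ℚ_[p] (Qpbar p))

/-- The canonical map `ℚ → ℂ_p`. -/
def qHomC : ℚ →+* S.Cp :=
  (qpHomC p S).comp (Rat.castHom ℚ_[p])

/-- The valuation domain `ℤ_{p,α} = {φ ∈ ℚ_p(X) : φ(α) ∈ O_p}` (as a subset of `ℚ_p(X)`). -/
def Zpa (α : S.Cp) : Set (RatFunc ℚ_[p]) :=
  {φ : RatFunc ℚ_[p] | φ.denom.eval₂ (qpHomC p S) α ≠ 0 ∧
    0 ≤ S.vC.v (φ.eval (qpHomC p S) α)}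

/-- The valuation domain `ℤ_{(p),α} = {φ ∈ ℚ(X) : φ(α) ∈ O_p}` (as a subset of `ℚ(X)`). -/
def Zpla (α : S.Cp) : Set (RatFunc ℚ) :=
  {φ : RatFunc ℚ | φ.denom.eval₂ (qHomC p S) α ≠ 0 ∧
    0 ≤ S.vC.v (φ.eval (qHomC p S) α)}

/-- Membership in the subfield `ℚ_p(α)` of `ℂ_p`. -/
def InQpAlpha (α x : S.Cp) : Prop :=
  ∃ f g : Polynomial ℚ_[p], g.eval₂ (qpHomC p S) α ≠ 0 ∧
    x = f.eval₂ (qpHomC p S) α / g.eval₂ (qpHomC p S) α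

/-- The value group `Γ_α ⊆ ℚ` of `ℚ_p(α) ⊆ ℂ_p`. -/
def valSetCp (α : S.Cp) : Set ℚ :=
  {γ : ℚ | ∃ x : S.Cp, InQpAlpha p S α x ∧ S.vC.v x = (γ : WithTop ℚ)}

/-- The residue field `k_α` of `O_{p,α} = O_p ∩ ℚ_p(α)` is finite. -/
def ResFieldFiniteCp (α : S.Cp) : Prop :=
  ∃ T : Finset S.Cp, ∀ x : S.Cp, InQpAlpha p S α x → 0 ≤ S.vC.v x →
    ∃ a ∈ T, 0 < S.vC.v (x - a)

/-- `α` and `β` are conjugate over `ℚ_p`: some element of `Gal(Q̄_p/ℚ_p)`, extended to its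
unique continuous (equivalently, isometric) automorphism of `ℂ_p`, maps `α` to `β`. -/
def ConjCp (α β : S.Cp) : Prop :=
  ∃ σ : S.Cp →+* S.Cp, (∀ c : ℚ_[p], σ (qpHomC p S c) = qpHomC p S c) ∧
    (∀ x : Qpbar p, ∃ y : Qpbar p, σ (S.emb x) = S.emb y) ∧
    (∀ x : S.Cp, S.vC.v (σ x) = S.vC.v x) ∧ σ α = β

end CpDefs

namespace AddVal

variable {K : Type} [Field K] (w : AddVal K)

lemma v_zero : w.v 0 = ⊤ := (w.v_eq_top_iff 0).2 rfl

lemma v_one : w.v 1 = 0 := by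
  have h := w.v_mul 1 1
  have h1 : w.v 1 ≠ ⊤ := fun h => one_ne_zero ((w.v_eq_top_iff 1).1 h)
  obtain ⟨q, hq⟩ := WithTop.ne_top_iff_exists.1 h1
  rw [one_mul, ← hq] at h
  rw [← hq]
  norm_cast at h ⊢
  linarith

/-- The valuation as a Mathlib additive valuation. -/
def toAddValuation : AddValuation K (WithTop ℚ) :=
  AddValuation.of w.v w.v_zero w.v_one w.min_le_v_add w.v_mul

@[simp] lemma toAddValuation_apply (x : K) : w.toAddValuation x = w.v x := rfl

lemma v_sub_comm (x y : K) : w.v (x - y) = w.v (y - x) := w.toAddValuation.map_sub_swap x y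

lemma v_pow (x : K) (n : ℕ) : w.v (x ^ n) = n • w.v x := w.toAddValuation.map_pow x n

lemma exists_v_eq {x : K} (hx : x ≠ 0) : ∃ q : ℚ, w.v x = q :=
  (WithTop.ne_top_iff_exists.1 fun h => hx ((w.v_eq_top_iff x).1 h)).imp fun _ h => h.symm

lemma min_le_v_sub (x y z : K) : min (w.v (x - y)) (w.v (y - z)) ≤ w.v (x - z) := by
  simpa using w.min_le_v_add (x - y) (y - z)

lemma v_sub_eq_of_lt {x y z : K} (h : w.v (x - y) < w.v (y - z)) :
    w.v (x - z) = w.v (x - y) := by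
  have h1 : w.v ((x - y) + (y - z)) = w.v (x - y) := w.toAddValuation.map_add_eq_of_lt_left h
  simpa using h1

lemma zero_le_v_div_iff {x y : K} (hy : y ≠ 0) : 0 ≤ w.v (x / y) ↔ w.v y ≤ w.v x := by
  obtain ⟨b, hb⟩ := w.exists_v_eq hy
  have h : w.v x = w.v (x / y) + w.v y := by rw [← w.v_mul, div_mul_cancel₀ _ hy]
  rw [h, hb]
  by_cases ht : w.v (x / y) = ⊤
  · simp [ht]
  · obtain ⟨q, hq⟩ := WithTop.ne_top_iff_exists.1 ht
    rw [← hq]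
    norm_cast
    constructor <;> intro h <;> linarith

lemma v_eval_eventually_eq {t : ℕ → K} {ν : K → ℚ}
    (ht : ∀ c, ∀ᶠ n in atTop, w.v (t n - c) = (ν c : WithTop ℚ)) [IsAlgClosed K] (f : K[X]) :
    ∀ᶠ n in atTop, w.v (f.eval (t n)) =
      w.v f.leadingCoeff + ((f.roots.map ν).sum : ℚ) := by
  have h : ∀ m : Multiset K, ∀ᶠ n in atTop,
      w.v ((m.map fun r => t n - r).prod) = ((m.map ν).sum : ℚ) := by
    intro m
    induction m using Multiset.induction with
    | empty => simp [w.v_one]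
    | cons a m ih =>
      filter_upwards [ih, ht a] with n h1 h2
      simp [w.v_mul, h1, h2]
  filter_upwards [h f.roots] with n hn
  rw [(IsAlgClosed.splits f).eval_eq_prod_roots, w.v_mul, hn]

end AddVal

section ZpE

variable {p}

lemma mem_ZpE_iff (S : PadicSetup p) (s : ℕ → Qpbar p) (φ : RatFunc ℚ_[p]) :
    φ ∈ ZpE p S s ↔ ∀ᶠ n in atTop,
      S.vbar.v ((φ.denom.map (algebraMap ℚ_[p] (Qpbar p))).eval (s n)) ≠ ⊤ ∧
      S.vbar.v ((φ.denom.map (algebraMap ℚ_[p] (Qpbar p))).eval (s n)) ≤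
        S.vbar.v ((φ.num.map (algebraMap ℚ_[p] (Qpbar p))).eval (s n)) := by
  refine eventually_congr (.of_forall fun n => ?_)
  simp only [ne_eq, S.vbar.v_eq_top_iff, eval_map, RatFunc.eval]
  exact and_congr_right fun h => S.vbar.zero_le_v_div_iff h

lemma ZpE_congr (S : PadicSetup p) {s t : ℕ → Qpbar p} {ν : Qpbar p → ℚ}
    (hs : ∀ c, ∀ᶠ n in atTop, S.vbar.v (s n - c) = (ν c : WithTop ℚ))
    (ht : ∀ c, ∀ᶠ n in atTop, S.vbar.v (t n - c) = (ν c : WithTop ℚ)) :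
    ZpE p S s = ZpE p S t := by
  ext φ
  rw [mem_ZpE_iff, mem_ZpE_iff]
  have key := fun f : ℚ_[p][X] =>
    (S.vbar.v_eval_eventually_eq hs (f.map (algebraMap ℚ_[p] (Qpbar p)))).and
      (S.vbar.v_eval_eventually_eq ht (f.map (algebraMap ℚ_[p] (Qpbar p))))
  refine eventually_congr ?_
  filter_upwards [key φ.num, key φ.denom] with n h1 h2
  rw [h1.1, h1.2, h2.1, h2.2]

end ZpE

namespace PadicSetup

variable {p} (S : PadicSetup p)

open Classical in
/-- The absolute value `p ^ (-v x)` attached to the valuation on `Q̄_p`. -/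
def absVal : AbsoluteValue (Qpbar p) ℝ where
  toFun x := if x = 0 then 0 else (p : ℝ) ^ (-(((S.vbar.v x).untopD 0 : ℚ) : ℝ))
  map_mul' x y := by
    have hp : (0 : ℝ) < p := by exact_mod_cast (Fact.out : p.Prime).pos
    by_cases hx : x = 0
    · simp [hx]
    by_cases hy : y = 0
    · simp [hy]
    obtain ⟨a, ha⟩ := S.vbar.exists_v_eq hx
    obtain ⟨b, hb⟩ := S.vbar.exists_v_eq hy
    have hab : S.vbar.v (x * y) = ((a + b : ℚ) : WithTop ℚ) := by rw [S.vbar.v_mul, ha, hb]; rfl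
    simp only [hx, hy, mul_eq_zero, or_self, if_false, ha, hb, hab, WithTop.untopD_coe]
    rw [← Real.rpow_add hp]
    push_cast
    ring_nf
  nonneg' x := by
    split_ifs
    · exact le_rfl
    · positivity
  eq_zero' x := by
    have hp : (0 : ℝ) < p := by exact_mod_cast (Fact.out : p.Prime).pos
    constructor
    · intro h
      by_contra hx
      rw [if_neg hx] at h
      exact (Real.rpow_pos_of_pos hp _).ne' h
    · intro h
      simp [h]
  add_le' x y := by
    have hp : (1 : ℝ) < p := by exact_mod_cast (Fact.out : p.Prime).one_lt
    have hp0 : (0 : ℝ) < p := by linarith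
    by_cases hx : x = 0
    · simp [hx]
    by_cases hy : y = 0
    · simp [hy]
    by_cases hxy : x + y = 0
    · rw [if_pos hxy]
      split_ifs
      positivity
    obtain ⟨a, ha⟩ := S.vbar.exists_v_eq hx
    obtain ⟨b, hb⟩ := S.vbar.exists_v_eq hy
    obtain ⟨c, hc⟩ := S.vbar.exists_v_eq hxy
    have h := S.vbar.min_le_v_add x y
    rw [ha, hb, hc] at h
    simp only [hx, hy, hxy, if_false, ha, hb, hc, WithTop.untopD_coe]
    norm_cast at h
    rcases min_le_iff.1 h with h | h
    · have : (p : ℝ) ^ (-(c : ℝ)) ≤ (p : ℝ) ^ (-(a : ℝ)) :=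
        Real.rpow_le_rpow_of_exponent_le hp.le (by simpa using h)
      have := Real.rpow_pos_of_pos hp0 (-(b : ℝ))
      linarith
    · have : (p : ℝ) ^ (-(c : ℝ)) ≤ (p : ℝ) ^ (-(b : ℝ)) :=
        Real.rpow_le_rpow_of_exponent_le hp.le (by simpa using h)
      have := Real.rpow_pos_of_pos hp0 (-(a : ℝ))
      linarith

open Classical in
lemma absVal_of_v_eq {x : Qpbar p} {q : ℚ} (h : S.vbar.v x = q) :
    S.absVal x = (p : ℝ) ^ (-(q : ℝ)) := by
  have hx : x ≠ 0 := by
    rintro rfl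
    rw [S.vbar.v_zero] at h
    exact WithTop.top_ne_coe h
  change (if x = 0 then 0 else (p : ℝ) ^ (-(((S.vbar.v x).untopD 0 : ℚ) : ℝ))) = _
  rw [if_neg hx, h, WithTop.untopD_coe]

lemma absVal_lt_iff (x : Qpbar p) (q : ℚ) :
    S.absVal x < (p : ℝ) ^ (-(q : ℝ)) ↔ (q : WithTop ℚ) < S.vbar.v x := by
  have hp : (1 : ℝ) < p := by exact_mod_cast (Fact.out : p.Prime).one_lt
  by_cases hx : x = 0
  · simp only [hx, map_zero, S.vbar.v_zero, WithTop.coe_lt_top, iff_true]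
    positivity
  · obtain ⟨a, ha⟩ := S.vbar.exists_v_eq hx
    rw [S.absVal_of_v_eq ha, ha, Real.rpow_lt_rpow_left_iff hp]
    norm_cast
    simp

lemma absVal_le_iff (x : Qpbar p) (q : ℚ) :
    S.absVal x ≤ (p : ℝ) ^ (-(q : ℝ)) ↔ (q : WithTop ℚ) ≤ S.vbar.v x := by
  have hp : (1 : ℝ) < p := by exact_mod_cast (Fact.out : p.Prime).one_lt
  by_cases hx : x = 0
  · simp only [hx, map_zero, S.vbar.v_zero, le_top, iff_true]
    positivity
  · obtain ⟨a, ha⟩ := S.vbar.exists_v_eq hx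
    rw [S.absVal_of_v_eq ha, ha, Real.rpow_le_rpow_left_iff hp]
    norm_cast
    simp

lemma absVal_algebraMap (x : ℚ_[p]) : S.absVal (algebraMap ℚ_[p] (Qpbar p) x) = ‖x‖ := by
  by_cases hx : x = 0
  · simp [hx]
  · rw [S.absVal_of_v_eq (S.vbar_extends x hx), Padic.norm_eq_zpow_neg_valuation hx]
    rw [← Real.rpow_intCast]
    push_cast
    rfl

lemma absVal_eq_spectralNorm (x : Qpbar p) :
    S.absVal x = spectralNorm ℚ_[p] (Qpbar p) x :=
  spectralNorm_unique_field_norm_ext S.absVal_algebraMap x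

lemma norm_coeff_minpoly_le {x : Qpbar p} {B : ℝ} (hB : 1 ≤ B) (hx : S.absVal x ≤ B) (n : ℕ) :
    ‖(minpoly ℚ_[p] x).coeff n‖ ≤ B ^ (minpoly ℚ_[p] x).natDegree := by
  have hmonic := minpoly.monic (Algebra.IsIntegral.isIntegral (R := ℚ_[p]) x)
  rcases lt_trichotomy n (minpoly ℚ_[p] x).natDegree with hn | hn | hn
  · have h1 : spectralValueTerms (minpoly ℚ_[p] x) n ≤ B :=
      (le_ciSup (spectralValueTerms_bddAbove _) n).trans
        (by rw [absVal_eq_spectralNorm] at hx; exact hx)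
    rw [spectralValueTerms_of_lt_natDegree _ hn] at h1
    have hpos : (0 : ℝ) < (minpoly ℚ_[p] x).natDegree - n := by
      rw [sub_pos]; exact_mod_cast hn
    rw [one_div, Real.rpow_inv_le_iff_of_pos (norm_nonneg _) (by linarith) hpos,
      ← Nat.cast_sub hn.le, Real.rpow_natCast] at h1
    exact h1.trans (pow_le_pow_right₀ hB (Nat.sub_le _ _))
  · rw [hn, hmonic.coeff_natDegree, norm_one]
    exact one_le_pow₀ hB
  · rw [coeff_eq_zero_of_natDegree_lt hn, norm_zero]
    positivity

end PadicSetup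

namespace PadicSetup

variable {p} (S : PadicSetup p)

lemma degOf_eq (x : Qpbar p) : degOf p x = (minpoly ℚ_[p] x).natDegree :=
  IntermediateField.adjoin.finrank (Algebra.IsIntegral.isIntegral x)

lemma degOf_pos (x : Qpbar p) : 0 < degOf p x := by
  rw [degOf_eq]
  exact minpoly.natDegree_pos (Algebra.IsIntegral.isIntegral x)

lemma degOf_le_of_monic {f : ℚ_[p][X]} (hf : f.Monic) {x : Qpbar p} (hx : aeval x f = 0) :
    degOf p x ≤ f.natDegree := by
  rw [degOf_eq]
  exact natDegree_le_of_dvd (minpoly.dvd _ _ hx) hf.ne_zero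

/-- Every element of degree at most `d` is a root of a monic polynomial of degree exactly `d`
whose coefficients are bounded in terms of `d` and the absolute value of the element. -/
lemma exists_monic_of_degOf_le {x : Qpbar p} {d : ℕ} (hd : degOf p x ≤ d) {B : ℝ} (hB : 1 ≤ B)
    (hx : S.absVal x ≤ B) :
    ∃ a : Fin d → ℚ_[p], (∀ i, ‖a i‖ ≤ B ^ d) ∧
      x ^ d + ∑ i, algebraMap ℚ_[p] (Qpbar p) (a i) * x ^ (i : ℕ) = 0 := by
  have hmonic := minpoly.monic (Algebra.IsIntegral.isIntegral (R := ℚ_[p]) x)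
  rw [degOf_eq] at hd
  set P := minpoly ℚ_[p] x * X ^ (d - (minpoly ℚ_[p] x).natDegree) with hP
  have hPm : P.Monic := hmonic.mul (monic_X_pow _)
  have hPd : P.natDegree = d := by
    rw [hP, hmonic.natDegree_mul (monic_X_pow _), natDegree_X_pow]
    omega
  refine ⟨fun i => P.coeff i, fun i => ?_, ?_⟩
  · simp only [hP, coeff_mul_X_pow']
    split_ifs
    · exact (S.norm_coeff_minpoly_le hB hx _).trans (pow_le_pow_right₀ hB hd)
    · rw [norm_zero]
      positivity
  · have h0 : aeval x P = 0 := by rw [hP, map_mul, minpoly.aeval, zero_mul]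
    rw [hPm.as_sum, hPd] at h0
    simpa [Finset.sum_range] using h0

/-- A bounded sequence of elements of bounded degree clusters at an element of the same degree. -/
lemma exists_frequently_absVal_sub_lt {c : ℕ → Qpbar p} {d : ℕ} (hd : ∀ k, degOf p (c k) ≤ d)
    {B : ℝ} (hB : 1 ≤ B) (hc : ∀ k, S.absVal (c k) ≤ B) :
    ∃ r : Qpbar p, degOf p r ≤ d ∧ ∀ ε > 0, ∃ᶠ k in atTop, S.absVal (c k - r) < ε := by
  choose a ha haeq using fun k => S.exists_monic_of_degOf_le (hd k) hB (hc k)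
  have hbdd : ∀ k, a k ∈ Metric.closedBall (0 : Fin d → ℚ_[p]) (B ^ d) := fun k => by
    rw [mem_closedBall_zero_iff, pi_norm_le_iff_of_nonneg (by positivity)]
    exact ha k
  obtain ⟨b, -, φ, hφ, hlim⟩ := tendsto_subseq_of_bounded Metric.isBounded_closedBall hbdd
  set Q : ℚ_[p][X] := X ^ d + ∑ i : Fin d, C (b i) * X ^ (i : ℕ) with hQ
  have hQdeg : (∑ i : Fin d, C (b i) * X ^ (i : ℕ)).degree < (d : WithBot ℕ) := by
    refine (degree_sum_le _ _).trans_lt ?_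
    rw [Finset.sup_lt_iff (by exact_mod_cast WithBot.bot_lt_coe d)]
    exact fun i _ => (degree_C_mul_X_pow_le _ _).trans_lt (by exact_mod_cast i.2)
  have hQm : Q.Monic := monic_X_pow_add hQdeg
  have hQd : Q.natDegree = d := by
    refine natDegree_eq_of_degree_eq_some ?_
    rw [hQ, degree_add_eq_left_of_degree_lt (by rwa [degree_X_pow]), degree_X_pow]
  have hQeval : ∀ k, aeval (c k) Q =
      ∑ i, algebraMap ℚ_[p] (Qpbar p) (b i - a k i) * c k ^ (i : ℕ) := fun k => by
    rw [← sub_zero (aeval (c k) Q), ← haeq k, hQ]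
    simp [sub_mul, Finset.sum_sub_distrib]
  have hsmall : Tendsto (fun k => S.absVal (aeval (c (φ k)) Q)) atTop (nhds 0) := by
    have hb : Tendsto (fun k => ∑ i : Fin d, ‖b i - a (φ k) i‖ * B ^ (i : ℕ)) atTop (nhds 0) := by
      rw [← Finset.sum_const_zero (s := (Finset.univ : Finset (Fin d)))]
      refine tendsto_finsetSum _ fun i _ => ?_
      have h1 : Tendsto (fun k => ‖b i - a (φ k) i‖) atTop (nhds 0) := by
        have h2 := (tendsto_pi_nhds.1 hlim i).const_sub (b i)
        simpa using h2.norm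
      simpa using h1.mul_const (B ^ (i : ℕ))
    refine squeeze_zero (fun k => S.absVal.nonneg _) (fun k => ?_) hb
    rw [hQeval]
    refine (S.absVal.sum_le _ _).trans (Finset.sum_le_sum fun i _ => ?_)
    rw [map_mul, map_pow, S.absVal_algebraMap]
    gcongr
    exact hc _
  set R := (Q.map (algebraMap ℚ_[p] (Qpbar p))).roots with hR
  have hQprod : ∀ x, S.absVal (aeval x Q) = (R.map fun r => S.absVal (x - r)).prod := fun x => by
    rw [aeval_def, ← eval_map,
      (IsAlgClosed.splits (Q.map (algebraMap ℚ_[p] (Qpbar p)))).eval_eq_prod_roots,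
      (hQm.map _).leadingCoeff, one_mul, map_multiset_prod, Multiset.map_map]
    rfl
  by_contra! hno
  have hroot : ∀ r ∈ R, ∃ ε > 0, ∀ᶠ k in atTop, ε ≤ S.absVal (c k - r) := fun r hr => by
    have hr0 : aeval r Q = 0 := by
      rw [aeval_def, ← eval_map]
      exact (mem_roots'.1 hr).2
    obtain ⟨ε, hε, h⟩ := hno r (by simpa [hQd] using degOf_le_of_monic hQm hr0)
    exact ⟨ε, hε, by simpa [Filter.not_frequently] using h⟩
  have hlow : ∀ m : Multiset (Qpbar p), (∀ r ∈ m, r ∈ R) →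
      ∃ ε > 0, ∀ᶠ k in atTop, ε ≤ (m.map fun r => S.absVal (c k - r)).prod := by
    intro m
    induction m using Multiset.induction with
    | empty => exact fun _ => ⟨1, one_pos, by simp⟩
    | cons r m ih =>
      intro h
      obtain ⟨ε, hε, h1⟩ := ih fun r hr => h r (Multiset.mem_cons_of_mem hr)
      obtain ⟨δ, hδ, h2⟩ := hroot r (h r (Multiset.mem_cons_self r m))
      refine ⟨δ * ε, mul_pos hδ hε, ?_⟩
      filter_upwards [h1, h2] with k h1 h2
      rw [Multiset.map_cons, Multiset.prod_cons]
      gcongr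
  obtain ⟨ε, hε, hev⟩ := hlow R fun _ h => h
  have h1 := hφ.tendsto_atTop.eventually hev
  obtain ⟨k, hk1, hk2⟩ := (h1.and (hsmall.eventually_lt_const hε)).exists
  rw [hQprod] at hk2
  exact absurd hk1 (not_le.2 hk2)

/-- `ν c` behaves like the valuation `v (x - c)` for a point `x`, of an extension of `Q̄_p`, at
which the approximation by elements of `Q̄_p` can always be improved. -/
structure IsApprox (ν : Qpbar p → ℚ) : Prop where
  min_le : ∀ c c', ((min (ν c) (ν c') : ℚ) : WithTop ℚ) ≤ S.vbar.v (c - c')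
  le : ∀ c c', min (ν c' : WithTop ℚ) (S.vbar.v (c - c')) ≤ ν c
  exists_lt : ∀ c, ∃ c', ν c < ν c'

namespace IsApprox

variable {S} {ν : Qpbar p → ℚ}

lemma v_sub_eq (h : S.IsApprox ν) {c c' : Qpbar p} (hlt : ν c < ν c') :
    S.vbar.v (c' - c) = ν c := by
  refine le_antisymm ?_ ?_
  · have h1 := h.le c c'
    rw [S.vbar.v_sub_comm c c'] at h1
    exact (min_le_iff.1 h1).resolve_left (by simpa using hlt)
  · have h1 := h.min_le c' c
    rwa [min_eq_right hlt.le] at h1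

/-- The quality of approximation by elements of bounded degree attains a maximum. -/
lemma exists_max (h : S.IsApprox ν) {d : ℕ} (hd : 1 ≤ d) :
    ∃ r, degOf p r ≤ d ∧ ∀ c, degOf p c ≤ d → ν c ≤ ν r := by
  have h0 : degOf p (0 : Qpbar p) ≤ d := by
    rw [degOf_eq, minpoly.zero, natDegree_X]
    exact hd
  let T : Set ℚ := {q | ∃ c, degOf p c ≤ d ∧ ν c = q ∧ ν 0 ≤ q}
  have : Nonempty T := ⟨⟨ν 0, 0, h0, rfl, le_rfl⟩⟩
  obtain ⟨u, hu, hulim⟩ := exists_seq_monotone_tendsto_atTop_atTop T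
  choose c hcd hcν hc0 using fun k => (u k).2
  obtain ⟨b, hb⟩ : ∃ b : ℚ, b ≤ ν 0 ∧ b ≤ 0 := ⟨min (ν 0) 0, min_le_left _ _, min_le_right _ _⟩
  have hp : (1 : ℝ) < p := by exact_mod_cast (Fact.out : p.Prime).one_lt
  have hbound : ∀ k, S.absVal (c k) ≤ (p : ℝ) ^ (-(b : ℝ)) := fun k => by
    rw [absVal_le_iff]
    have h1 := h.min_le (c k) 0
    rw [sub_zero, min_eq_right (by rw [hcν]; exact hc0 k)] at h1
    exact le_trans (by exact_mod_cast hb.1) h1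
  obtain ⟨r, hrd, hr⟩ := S.exists_frequently_absVal_sub_lt hcd
    (Real.one_le_rpow hp.le (by simpa using hb.2)) hbound
  have key : ∀ q : T, (q : ℚ) ≤ ν r := fun q => by
    obtain ⟨k, hk1, hk2⟩ := ((hr ((p : ℝ) ^ (-((q : ℚ) : ℝ))) (by positivity)).and_eventually
      (hulim.eventually_ge_atTop q)).exists
    rw [absVal_lt_iff] at hk1
    have h1 := h.le r (c k)
    rw [S.vbar.v_sub_comm, hcν] at h1
    have h2 : ((q : ℚ) : WithTop ℚ) ≤ ν r :=
      (le_min (by exact_mod_cast hk2) hk1.le).trans h1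
    exact_mod_cast h2
  refine ⟨r, hrd, fun c hc => ?_⟩
  rcases le_total (ν 0) (ν c) with h1 | h1
  · exact key ⟨ν c, c, hc, rfl, h1⟩
  · exact h1.trans (key ⟨ν 0, 0, h0, rfl, le_rfl⟩)

lemma exists_next (h : S.IsApprox ν) (r : Qpbar p) (hr : ∀ c, degOf p c ≤ degOf p r → ν c ≤ ν r) :
    ∃ r', degOf p r < degOf p r' ∧ ν r < ν r' ∧
      (∀ c, degOf p c < degOf p r' → ν c ≤ ν r) ∧
      (∀ c, degOf p c ≤ degOf p r' → ν c ≤ ν r') := by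
  classical
  have hex : ∃ d, ∃ c, degOf p c = d ∧ ν r < ν c := by
    obtain ⟨c, hc⟩ := h.exists_lt r
    exact ⟨_, c, rfl, hc⟩
  obtain ⟨c, hcd, hc⟩ := Nat.find_spec hex
  have hmin : ∀ c', degOf p c' < Nat.find hex → ν c' ≤ ν r := fun c' hc' => by
    by_contra! hlt
    exact Nat.find_min hex hc' ⟨c', rfl, hlt⟩
  obtain ⟨r', hr'd, hr'⟩ := h.exists_max (d := Nat.find hex) (hcd ▸ degOf_pos c)
  have hlt : ν r < ν r' := hc.trans_le (hr' c hcd.le)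
  have hdeg : degOf p r' = Nat.find hex :=
    hr'd.antisymm (by by_contra! hd; exact absurd (hmin r' hd) (not_le.2 hlt))
  refine ⟨r', ?_, hlt, by rwa [hdeg], by rwa [hdeg]⟩
  by_contra! hd
  exact absurd (hr r' hd) (not_le.2 hlt)

/-- An approximation function is realised by a strongly stacked sequence. -/
lemma exists_isStronglyStacked (h : S.IsApprox ν) :
    ∃ t : ℕ → Qpbar p, IsStronglyStacked p S t ∧ StrictMono (fun n => ν (t n)) ∧
      ∀ c, ∃ n, ν c < ν (t n) := by
  let A := {r : Qpbar p // ∀ c, degOf p c ≤ degOf p r → ν c ≤ ν r}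
  choose nx h1 h2 h3 h4 using fun r : A => h.exists_next r.1 r.2
  obtain ⟨r₀, hr₀d, hr₀⟩ := h.exists_max le_rfl
  have hr₀1 : degOf p r₀ = 1 := hr₀d.antisymm (degOf_pos r₀)
  let u : ℕ → A := fun n => Nat.rec ⟨r₀, by rwa [hr₀1]⟩ (fun _ r => ⟨nx r, h4 r⟩) n
  have hmono : StrictMono fun n => ν (u n).1 := strictMono_nat_of_lt_succ fun n => h2 (u n)
  have hdeg : StrictMono fun n => degOf p (u n).1 := strictMono_nat_of_lt_succ fun n => h1 (u n)
  have hv : ∀ n, S.vbar.v ((u (n + 1)).1 - (u n).1) = ν (u n).1 := fun n =>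
    h.v_sub_eq (h2 (u n))
  refine ⟨fun n => (u n).1, ⟨⟨?_, fun n => h1 (u n), fun n c hc => ?_⟩, fun n c hc => ?_⟩, hmono,
    fun c => ?_⟩
  · have hbot : IntermediateField.adjoin ℚ_[p] {r₀} = ⊥ :=
      IntermediateField.finrank_eq_one_iff.1 hr₀1
    obtain ⟨a, ha⟩ := IntermediateField.mem_bot.1
      (hbot ▸ IntermediateField.mem_adjoin_simple_self ℚ_[p] r₀)
    exact ⟨a, ha.symm⟩
  · rw [hv]
    cases n with
    | zero => exact absurd hc (by have := degOf_pos c; change ¬ _ < degOf p r₀; omega)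
    | succ n =>
      have hc' : ν c < ν (u (n + 1)).1 := (h3 (u n) c hc).trans_lt (h2 (u n))
      rw [h.v_sub_eq hc']
      exact_mod_cast hc'
  · rw [hv]
    have hc' := h3 (u n) c hc
    rw [h.v_sub_eq (hc'.trans_lt (h2 (u n)))]
    exact_mod_cast hc'
  · refine ⟨degOf p c + 1, ((u (degOf p c)).2 c hdeg.le_apply).trans_lt
      (hmono (Nat.lt_succ_self _))⟩

lemma eventually_v_sub_eq (h : S.IsApprox ν) {t : ℕ → Qpbar p} (ht : StrictMono fun n => ν (t n))
    (hcof : ∀ c, ∃ n, ν c < ν (t n)) (c : Qpbar p) :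
    ∀ᶠ n in atTop, S.vbar.v (t n - c) = (ν c : WithTop ℚ) := by
  obtain ⟨N, hN⟩ := hcof c
  filter_upwards [eventually_ge_atTop N] with n hn
  exact h.v_sub_eq (hN.trans_le (ht.monotone hn))

end IsApprox

end PadicSetup

namespace AddVal

variable {K : Type} [Field K] (w : AddVal K)

/-- A pseudo-convergent sequence of transcendental type has no pseudo-limits: the values
`v (s n - c)` eventually stabilise strictly below the gauge of the sequence. -/
lemma exists_eventual_value {s : ℕ → K} (hs : w.IsPseudoConvergent s)
    (ht : w.IsTranscendentalType s) (c : K) :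
    ∃ q : ℚ, (∀ᶠ n in atTop, w.v (s n - c) = q) ∧
      ∃ n, (q : WithTop ℚ) < w.v (s (n + 1) - s n) := by
  obtain ⟨N, hN⟩ := ht (X - C c)
  have hN' : ∀ m ≥ N, ∀ n ≥ N, w.v (s m - c) = w.v (s n - c) := by simpa using hN
  have hlt : ∃ n, N ≤ n ∧ w.v (s n - c) < w.v (s (n + 1) - s n) := by
    by_contra! hno
    have h1 := hno N le_rfl
    have h2 := hno (N + 1) (by omega)
    have h3 : w.v (s N - s (N + 1)) < w.v (s (N + 1) - s (N + 2)) :=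
      hs (Nat.lt_succ_self _) (Nat.lt_succ_self _)
    rw [hN' (N + 1) (by omega) N le_rfl, w.v_sub_comm] at h2
    have h4 : w.v (s N - c) = w.v (s N - s (N + 1)) :=
      w.v_sub_eq_of_lt (h3.trans_le (by rwa [hN' (N + 1) (by omega) N le_rfl]))
    rw [h4] at h2
    exact absurd h3 (not_lt.2 h2)
  obtain ⟨n, hn, hlt⟩ := hlt
  obtain ⟨q, hq⟩ := WithTop.ne_top_iff_exists.1 (ne_top_of_lt hlt)
  refine ⟨q, ?_, n, by rwa [hq]⟩
  filter_upwards [eventually_ge_atTop N] with m hm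
  rw [hq, hN' m hm n hn]

end AddVal

lemma exists_isStronglyStacked_equiv {p : ℕ} [Fact p.Prime] (S : PadicSetup p)
    {s : ℕ → Qpbar p} (hs : S.vbar.IsPseudoConvergent s) (hst : S.vbar.IsTranscendentalType s) :
    ∃ t : ℕ → Qpbar p, IsStronglyStacked p S t ∧ S.vbar.SeqEquiv s t ∧ ZpE p S s = ZpE p S t := by
  choose ν hν hνlt using S.vbar.exists_eventual_value hs hst
  have hgap : ∀ ⦃n m : ℕ⦄, n < m → S.vbar.v (s m - s n) = S.vbar.v (s (n + 1) - s n) := by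
    intro n m hnm
    rcases (Nat.succ_le_of_lt hnm).eq_or_lt with h | h
    · rw [← h]
    · rw [S.vbar.v_sub_comm (s m), S.vbar.v_sub_comm (s (n + 1))]
      exact S.vbar.v_sub_eq_of_lt (hs (Nat.lt_succ_self n) h)
  have hνs : ∀ n, S.vbar.v (s (n + 1) - s n) = ν (s n) := fun n => by
    obtain ⟨m, hm1, hm2⟩ := ((hν (s n)).and (eventually_gt_atTop n)).exists
    rw [← hm1, hgap hm2]
  have happ : S.IsApprox ν := by
    refine ⟨fun c c' => ?_, fun c c' => ?_, fun c => ?_⟩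
    · obtain ⟨m, h1, h2⟩ := ((hν c).and (hν c')).exists
      have h3 := S.vbar.min_le_v_sub c (s m) c'
      rw [S.vbar.v_sub_comm c, h1, h2] at h3
      exact_mod_cast h3
    · obtain ⟨m, h1, h2⟩ := ((hν c).and (hν c')).exists
      have h3 := S.vbar.min_le_v_sub (s m) c' c
      rwa [S.vbar.v_sub_comm c' c, h1, h2] at h3
    · obtain ⟨n, hn⟩ := hνlt c
      rw [hνs] at hn
      exact ⟨s n, by exact_mod_cast hn⟩
  obtain ⟨t, ht, hmono, hcof⟩ := happ.exists_isStronglyStacked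
  have hνt : ∀ n, S.vbar.v (t (n + 1) - t n) = ν (t n) := fun n =>
    happ.v_sub_eq (hmono (Nat.lt_succ_self n))
  have hmonos : StrictMono fun n => ν (s n) := strictMono_nat_of_lt_succ fun n => by
    have h1 : S.vbar.v (s n - s (n + 1)) < S.vbar.v (s (n + 1) - s (n + 2)) :=
      hs (Nat.lt_succ_self n) (Nat.lt_succ_self (n + 1))
    rw [S.vbar.v_sub_comm (s n), S.vbar.v_sub_comm (s (n + 1)) (s (n + 2)), hνs, hνs] at h1
    exact_mod_cast h1
  refine ⟨t, ht, ⟨?_, fun k => ?_⟩, ZpE_congr S hν (happ.eventually_v_sub_eq hmono hcof)⟩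
  · ext x
    change (∀ n, _) ↔ ∀ n, _
    simp only [hνs, hνt]
    constructor
    · intro h n
      obtain ⟨m, hm⟩ := hνlt (t n)
      rw [hνs] at hm
      exact hm.trans (h m)
    · intro h n
      obtain ⟨m, hm⟩ := hcof (s n)
      exact lt_trans (by exact_mod_cast hm) (h m)
  · obtain ⟨j₀, hj₀⟩ := hcof (s k)
    refine ⟨k + 1, j₀, fun i hi j hj => ?_⟩
    rw [hνs]
    refine lt_of_lt_of_le ?_ (happ.min_le (s i) (t j))
    exact_mod_cast lt_min (hmonos hi) (hj₀.trans_le (hmono.monotone hj))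

section AlgebraicExtension

variable {K L : Type*} [Field K] [Field L] [Algebra K L]

/-- A valuation subring extends along any field extension. -/
lemma ValuationSubring.exists_extension (W : ValuationSubring K) :
    ∃ V : ValuationSubring L, ∀ x : K, algebraMap K L x ∈ V ↔ x ∈ W := by
  obtain ⟨V, h, hloc⟩ :=
    IsLocalRing.exists_factor_valuationRing ((algebraMap K L).comp W.subtype)
  have hmem : ∀ x ∈ W, algebraMap K L x ∈ V := fun x hx => h ⟨x, hx⟩
  refine ⟨V, fun x => ⟨fun hx => ?_, hmem x⟩⟩
  rcases W.mem_or_inv_mem x with hW | hW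
  · exact hW
  · by_cases hx0 : x = 0
    · rw [hx0]
      exact W.zero_mem
    have hu : IsUnit (((algebraMap K L).comp W.subtype).codRestrict V.toSubring h ⟨x⁻¹, hW⟩) := by
      refine IsUnit.of_mul_eq_one ⟨algebraMap K L x, hx⟩ (Subtype.ext ?_)
      change algebraMap K L x⁻¹ * algebraMap K L x = 1
      rw [← map_mul, inv_mul_cancel₀ hx0, map_one]
    obtain ⟨y, hy⟩ := (hloc.map_nonunit _ hu).exists_right_inv
    have hxy : x⁻¹ * y = 1 := congrArg Subtype.val hy
    have : (y : K) = x := by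
      rw [← inv_inv x]
      exact eq_inv_of_mul_eq_one_right hxy
    rw [← this]
    exact y.2

/-- Up to a power, values on an algebraic extension are values on the base field. -/
lemma Valuation.exists_pow_eq_of_isAlgebraic {Γ : Type*} [LinearOrderedCommGroupWithZero Γ]
    (u : Valuation L Γ) {x : L} (hx : x ≠ 0) (hxa : IsAlgebraic K x) :
    ∃ n : ℕ, 1 ≤ n ∧ ∃ y : K, y ≠ 0 ∧ u x ^ n = u (algebraMap K L y) := by
  classical
  set P := minpoly K x with hP
  have hP0 : P ≠ 0 := minpoly.ne_zero hxa.isIntegral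
  set f : ℕ → L := fun i => algebraMap K L (P.coeff i) * x ^ i with hf
  have hf0 : ∀ i ∈ P.support, u (f i) ≠ 0 := fun i hi => by
    rw [u.ne_zero_iff]
    exact mul_ne_zero (by simpa using mem_support_iff.1 hi) (pow_ne_zero _ hx)
  obtain ⟨j, hj, hmax⟩ := P.support.exists_max_image (fun i => u (f i))
    (support_nonempty.2 hP0)
  have hsum : ∑ i ∈ P.support, f i = 0 := by
    have h := minpoly.aeval K x
    rw [aeval_def, eval₂_eq_sum] at h
    exact h
  obtain ⟨i, hi, hij, heq⟩ : ∃ i ∈ P.support, i ≠ j ∧ u (f i) = u (f j) := by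
    by_contra! hno
    have h := u.map_sum_eq_of_lt hj fun i hi => by
      rw [Finset.mem_sdiff, Finset.mem_singleton] at hi
      exact lt_of_le_of_ne (hmax i hi.1) (hno i hi.1 hi.2)
    rw [hsum, map_zero] at h
    exact hf0 j hj h.symm
  have main : ∀ a b : ℕ, a < b → a ∈ P.support → b ∈ P.support → u (f a) = u (f b) →
      ∃ n : ℕ, 1 ≤ n ∧ ∃ y : K, y ≠ 0 ∧ u x ^ n = u (algebraMap K L y) := by
    intro a b hab ha hb h
    rw [mem_support_iff] at ha hb
    refine ⟨b - a, by omega, P.coeff a / P.coeff b, div_ne_zero ha hb, ?_⟩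
    have hux : u x ≠ 0 := u.ne_zero_iff.2 hx
    have hub : u (algebraMap K L (P.coeff b)) ≠ 0 := u.ne_zero_iff.2 (by simpa using hb)
    rw [map_div₀, map_div₀, eq_div_iff hub]
    simp only [hf, map_mul, map_pow] at h
    apply mul_right_cancel₀ (pow_ne_zero a hux)
    rw [h, mul_right_comm, ← pow_add, Nat.sub_add_cancel hab.le, mul_comm]
  rcases lt_or_gt_of_ne hij with h | h
  · exact main i j h hi hj heq
  · exact main j i h hj hi heq.symm

/-- A root of a nonzero polynomial over a field that is integral over `ℤ` is integral over `ℤ`. -/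
lemma exists_monic_int_eval₂_eq_zero {k k' : Type*} [Field k] [Field k'] (f : k →+* k')
    (hk : ∀ z : k, IsIntegral ℤ z) {P : k[X]} {ξ : k'} (hP : P ≠ 0) (hξ : P.eval₂ f ξ = 0) :
    ∃ g : ℤ[X], g.Monic ∧ g.eval₂ (Int.castRingHom k') ξ = 0 := by
  let _ : Algebra k k' := f.toAlgebra
  have hξ' : IsAlgebraic k ξ := ⟨P, hP, hξ⟩
  have : Algebra.IsIntegral ℤ k := ⟨hk⟩
  exact isIntegral_trans (R := ℤ) ξ hξ'.isIntegral

/-- If the residue field of `W` is integral over `ℤ`, then so is the residue field of any extension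
of `W` to an algebraic extension. -/
lemma ValuationSubring.exists_monic_aeval_lt_one {W : ValuationSubring K} {V : ValuationSubring L}
    (hWV : ∀ x : K, algebraMap K L x ∈ V ↔ x ∈ W)
    (hW : ∀ z : IsLocalRing.ResidueField W, IsIntegral ℤ z) {x : L} (hx : x ∈ V)
    (hxa : IsAlgebraic K x) :
    ∃ g : ℤ[X], g.Monic ∧ V.valuation (aeval x g) < 1 := by
  let i : W →+* V :=
    { toFun := fun a => ⟨algebraMap K L a, (hWV _).2 a.2⟩
      map_one' := Subtype.ext (map_one _)
      map_zero' := Subtype.ext (map_zero _)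
      map_mul' := fun a b => Subtype.ext (map_mul (algebraMap K L) (a : K) (b : K))
      map_add' := fun a b => Subtype.ext (map_add (algebraMap K L) (a : K) (b : K)) }
  have hloc : IsLocalHom i := ⟨fun a ha => by
    obtain ⟨y, hy⟩ := ha.exists_right_inv
    have hy' : algebraMap K L a * y = 1 := congrArg Subtype.val hy
    have ha0 : (a : K) ≠ 0 := by
      intro h0
      rw [h0, map_zero, zero_mul] at hy'
      exact zero_ne_one hy'
    have hinv : (a : K)⁻¹ ∈ W := by
      rw [← hWV, map_inv₀, inv_eq_of_mul_eq_one_right hy']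
      exact y.2
    exact IsUnit.of_mul_eq_one ⟨(a : K)⁻¹, hinv⟩ (Subtype.ext (mul_inv_cancel₀ ha0))⟩
  set P := minpoly K x
  have hP0 : P ≠ 0 := minpoly.ne_zero hxa.isIntegral
  obtain ⟨j, hj, hmax⟩ := P.support.exists_max_image (fun i => W.valuation (P.coeff i))
    (support_nonempty.2 hP0)
  have hj0 : P.coeff j ≠ 0 := mem_support_iff.1 hj
  have hlift : C (P.coeff j)⁻¹ * P ∈ lifts W.subtype := by
    rw [lifts_iff_coeff_lifts]
    intro n
    rw [coeff_C_mul]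
    by_cases hn : P.coeff n = 0
    · exact ⟨0, by simp [hn]⟩
    · refine ⟨⟨(P.coeff j)⁻¹ * P.coeff n, ?_⟩, rfl⟩
      rw [← W.valuation_le_one_iff, map_mul, map_inv₀, inv_mul_le_one₀]
      · exact hmax n (mem_support_iff.2 hn)
      · exact zero_lt_iff.2 (W.valuation.ne_zero_iff.2 hj0)
  obtain ⟨B, hB⟩ := (mem_lifts _).1 hlift
  have hBj : B.coeff j = 1 := Subtype.ext (by
    have h := congrArg (fun q => q.coeff j) hB
    simpa [hj0] using h)
  have hBx : B.eval₂ i ⟨x, hx⟩ = 0 := Subtype.ext (by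
    change V.subtype (B.eval₂ i ⟨x, hx⟩) = 0
    rw [hom_eval₂]
    change B.eval₂ ((algebraMap K L).comp W.subtype) x = 0
    rw [← eval₂_map, hB, ← aeval_def, map_mul, minpoly.aeval, mul_zero])
  set ξ : IsLocalRing.ResidueField V := IsLocalRing.residue V ⟨x, hx⟩
  obtain ⟨g, hg, hg0⟩ := exists_monic_int_eval₂_eq_zero (IsLocalRing.ResidueField.map i) hW
    (P := B.map (IsLocalRing.residue W)) (ξ := ξ)
    (fun h0 => by
      have h := congrArg (fun q => q.coeff j) h0
      simp [hBj] at h)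
    (by
      rw [eval₂_map]
      have h := congrArg (IsLocalRing.residue V) hBx
      rwa [hom_eval₂, map_zero] at h)
  refine ⟨g, hg, ?_⟩
  have hres : IsLocalRing.residue V (aeval (⟨x, hx⟩ : V) g) = 0 := by
    rw [aeval_def, hom_eval₂, ← hg0]
    congr 1
  rw [IsLocalRing.residue_eq_zero_iff, V.valuation_lt_one_iff] at hres
  convert hres using 2
  change _ = V.subtype _
  rw [aeval_def, aeval_def, hom_eval₂]
  congr 1

end AlgebraicExtension

namespace PadicSetup

variable {p} (S : PadicSetup p) {L : Type*} [Field L] [Algebra ℚ_[p] L] (ι : Qpbar p →ₐ[ℚ_[p]] L)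
  {V : ValuationSubring L}

lemma algHom_mem_iff (hV : ∀ c : ℚ_[p], algebraMap ℚ_[p] L c ∈ V ↔ ‖c‖ ≤ 1) (x : Qpbar p) :
    ι x ∈ V ↔ 0 ≤ S.vbar.v x := by
  have hmem : ∀ x : Qpbar p, 0 ≤ S.vbar.v x → ι x ∈ V := by
    intro x hx
    have hx1 : S.absVal x ≤ 1 := by
      have h := (S.absVal_le_iff x 0).2 (by simpa using hx)
      simpa using h
    have hlift : (minpoly ℚ_[p] x).map (algebraMap ℚ_[p] L) ∈ lifts V.subtype := by
      rw [lifts_iff_coeff_lifts]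
      intro n
      rw [coeff_map]
      refine ⟨⟨_, (hV _).2 ?_⟩, rfl⟩
      simpa using S.norm_coeff_minpoly_le le_rfl hx1 n
    have hmonic := minpoly.monic (Algebra.IsIntegral.isIntegral (R := ℚ_[p]) x)
    obtain ⟨Q, hQ, -, hQm⟩ := lifts_and_degree_eq_and_monic hlift (hmonic.map _)
    have h_integral : IsIntegral V (ι x) := by
      refine ⟨Q, hQm, ?_⟩
      change Q.eval₂ V.subtype (ι x) = 0
      rw [← eval_map, hQ, eval_map_algebraMap, aeval_algHom_apply, minpoly.aeval, map_zero]
    obtain ⟨y, hy⟩ := IsIntegrallyClosed.isIntegral_iff.1 h_integral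
    rw [← hy]
    exact y.2
  refine ⟨fun hx => ?_, hmem x⟩
  by_contra! hlt
  have hx0 : x ≠ 0 := by
    rintro rfl
    simp [S.vbar.v_zero] at hlt
  obtain ⟨q, hq⟩ := S.vbar.exists_v_eq hx0
  have hq0 : q < 0 := by
    rw [hq] at hlt
    exact_mod_cast hlt
  obtain ⟨n, hn⟩ := exists_nat_gt (1 / -q)
  have hn1 : n * q ≤ -1 := by
    rw [div_lt_iff₀ (by linarith)] at hn
    linarith
  have hp0 : (p : ℚ_[p]) ≠ 0 := by exact_mod_cast (Fact.out : p.Prime).ne_zero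
  have hpi : S.vbar.v (algebraMap ℚ_[p] (Qpbar p) p) = ((1 : ℚ) : WithTop ℚ) := by
    rw [S.vbar_extends _ hp0]
    simp
  have hv : 0 ≤ S.vbar.v (algebraMap ℚ_[p] (Qpbar p) (p : ℚ_[p])⁻¹ / x ^ n) := by
    rw [map_inv₀, inv_eq_one_div, div_div, S.vbar.zero_le_v_div_iff
      (mul_ne_zero (by simpa using hp0) (pow_ne_zero _ hx0)), S.vbar.v_mul, S.vbar.v_pow, hpi, hq,
      S.vbar.v_one, ← WithTop.coe_nsmul, ← WithTop.coe_add, ← WithTop.coe_zero, WithTop.coe_le_coe,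
      nsmul_eq_mul]
    linarith
  have h1 : algebraMap ℚ_[p] L (p : ℚ_[p])⁻¹ ∈ V := by
    have h2 := V.mul_mem _ _ (hmem _ hv) (pow_mem hx n)
    rwa [← map_pow, ← map_mul, div_mul_cancel₀ _ (pow_ne_zero _ hx0), AlgHom.commutes] at h2
  rw [hV, norm_inv, Padic.norm_p, inv_inv] at h1
  exact absurd h1 (not_le.2 (by exact_mod_cast (Fact.out : p.Prime).one_lt))

lemma valuation_algHom_le_iff (hV : ∀ c : ℚ_[p], algebraMap ℚ_[p] L c ∈ V ↔ ‖c‖ ≤ 1)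
    (x y : Qpbar p) : V.valuation (ι x) ≤ V.valuation (ι y) ↔ S.vbar.v y ≤ S.vbar.v x := by
  by_cases hy : y = 0
  · simp [hy, S.vbar.v_zero, S.vbar.v_eq_top_iff]
  · have hy' : V.valuation (ι y) ≠ 0 := by simpa using hy
    rw [← S.vbar.zero_le_v_div_iff hy, ← S.algHom_mem_iff ι hV, ← V.valuation_le_one_iff,
      map_div₀, map_div₀, div_le_one₀ (zero_lt_iff.2 hy')]

lemma exists_isApprox (hV : ∀ c : ℚ_[p], algebraMap ℚ_[p] L c ∈ V ↔ ‖c‖ ≤ 1) {ξ : L}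
    (hξ : ∀ c, ξ ≠ ι c)
    (hval : ∀ y : L, y ≠ 0 → ∃ a : Qpbar p, a ≠ 0 ∧ V.valuation y = V.valuation (ι a))
    (hres : ∀ x ∈ V, ∃ g : ℤ[X], g.Monic ∧ V.valuation (aeval x g) < 1) :
    ∃ ν : Qpbar p → ℚ, S.IsApprox ν ∧
      ∀ c a, V.valuation (ξ - ι c) = V.valuation (ι a) → S.vbar.v a = (ν c : WithTop ℚ) := by
  choose α hα0 hα using fun c => hval (ξ - ι c) (sub_ne_zero.2 (hξ c))
  choose ν hν using fun c => S.vbar.exists_v_eq (hα0 c)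
  have hle := S.valuation_algHom_le_iff ι hV
  refine ⟨ν, ⟨fun c c' => ?_, fun c c' => ?_, fun c => ?_⟩, fun c a h => ?_⟩
  · have h : V.valuation (ι (c - c')) ≤ max (V.valuation (ξ - ι c')) (V.valuation (ξ - ι c)) := by
      rw [map_sub]
      simpa using V.valuation.map_sub (ξ - ι c') (ξ - ι c)
    rw [le_max_iff, hα, hα, hle, hle, hν, hν] at h
    rw [WithTop.coe_min, min_le_iff]
    exact h.symm
  · have h : V.valuation (ξ - ι c) ≤ max (V.valuation (ξ - ι c')) (V.valuation (ι (c - c'))) := by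
      rw [map_sub ι]
      simpa using V.valuation.map_sub (ξ - ι c') (ι c - ι c')
    rw [le_max_iff, hα, hα, hle, hle, hν, hν] at h
    rwa [min_le_iff]
  · have hα' : V.valuation (ι (α c)) ≠ 0 := by simpa using hα0 c
    obtain ⟨g, hg, hg1⟩ := hres ((ξ - ι c) / ι (α c)) (by
      rw [← V.valuation_le_one_iff, map_div₀, hα, div_self hα'])
    set G : (Qpbar p)[X] := g.map (Int.castRingHom _) with hG
    have hGm : G.Monic := hg.map _
    have hprod : aeval ((ξ - ι c) / ι (α c)) g =
        (G.roots.map fun b => (ξ - ι c) / ι (α c) - ι b).prod := by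
      have h1 : G = (G.roots.map fun b => X - C b).prod := by
        have := (IsAlgClosed.splits G).eq_prod_roots
        rwa [hGm.leadingCoeff, C_1, one_mul] at this
      have h2 : aeval ((ξ - ι c) / ι (α c)) g =
          G.eval₂ (ι : Qpbar p →+* L) ((ξ - ι c) / ι (α c)) := by
        rw [hG, eval₂_map, aeval_def]
        congr 1
        exact RingHom.ext_int _ _
      rw [h2]
      conv_lhs => rw [h1]
      rw [eval₂_multiset_prod, Multiset.map_map]
      simp
    obtain ⟨b, hb⟩ : ∃ b, V.valuation ((ξ - ι c) / ι (α c) - ι b) < 1 := by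
      by_contra! hno
      rw [hprod, map_multiset_prod, Multiset.map_map] at hg1
      refine absurd hg1 (not_lt.2 ?_)
      refine Multiset.one_le_prod_of_one_le fun q hq => ?_
      obtain ⟨b, -, rfl⟩ := Multiset.mem_map.1 hq
      exact hno b
    refine ⟨c + α c * b, ?_⟩
    have hlt : V.valuation (ι (α (c + α c * b))) < V.valuation (ι (α c)) := by
      rw [← hα, map_add, map_mul]
      have : ξ - (ι c + ι (α c) * ι b) = ((ξ - ι c) / ι (α c) - ι b) * ι (α c) := by
        have : ι (α c) ≠ 0 := by simpa using hα0 c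
        field_simp
        ring
      rw [this, map_mul]
      exact mul_lt_of_lt_one_left (zero_lt_iff.2 hα') hb
    rw [← not_le, hle, hν, hν, not_le] at hlt
    exact_mod_cast hlt
  · rw [hα] at h
    rw [← hν]
    exact le_antisymm ((hle _ _).1 h.le) ((hle _ _).1 h.ge)

end PadicSetup

/-- Over an algebraic extension of `ℚ_p(X)`, a torsion extension of `ℤ_p` takes no values beyond
those of `Q̄_p`. -/
lemma IsResAlgTorsionQp.exists_valuation_eq {p : ℕ} [Fact p.Prime]
    {W : ValuationSubring (RatFunc ℚ_[p])} (hW : IsResAlgTorsionQp p W)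
    {L : Type*} [Field L] [Algebra ℚ_[p] L] [Algebra (RatFunc ℚ_[p]) L]
    [IsScalarTower ℚ_[p] (RatFunc ℚ_[p]) L] [Algebra.IsAlgebraic (RatFunc ℚ_[p]) L]
    (ι : Qpbar p →ₐ[ℚ_[p]] L) {V : ValuationSubring L}
    (hWV : ∀ x : RatFunc ℚ_[p], algebraMap _ L x ∈ V ↔ x ∈ W) (y : L) (hy : y ≠ 0) :
    ∃ a : Qpbar p, a ≠ 0 ∧ V.valuation y = V.valuation (ι a) := by
  obtain ⟨n, hn, φ, hφ, h1⟩ := V.valuation.exists_pow_eq_of_isAlgebraic hy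
    (Algebra.IsAlgebraic.isAlgebraic (R := RatFunc ℚ_[p]) y)
  obtain ⟨m, hm, c, hc, h2, h3⟩ := hW.2.2 φ hφ
  have hφ' : V.valuation (algebraMap _ L φ) ≠ 0 := by simpa using hφ
  have hc' : V.valuation (algebraMap _ L (RatFunc.C c)) ≠ 0 := by simpa using hc
  have h4 : V.valuation (algebraMap _ L φ) ^ m = V.valuation (algebraMap _ L (RatFunc.C c)) := by
    rw [← hWV, ← V.valuation_le_one_iff, map_div₀, map_div₀, map_pow, map_pow] at h2 h3
    rw [div_le_one₀ (zero_lt_iff.2 hc')] at h2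
    rw [div_le_one₀ (pow_pos (zero_lt_iff.2 hφ') m)] at h3
    exact le_antisymm h2 h3
  obtain ⟨a, ha⟩ := IsAlgClosed.exists_pow_nat_eq (algebraMap ℚ_[p] (Qpbar p) c)
    (n := n * m) (Nat.mul_pos hn hm)
  have hnm : n * m ≠ 0 := (Nat.mul_pos hn hm).ne'
  refine ⟨a, ?_, ?_⟩
  · rintro rfl
    rw [zero_pow hnm] at ha
    exact hc (by simpa using ha.symm)
  · rw [← pow_left_inj₀ zero_le zero_le hnm]
    rw [pow_mul, h1, h4, ← map_pow, ← map_pow, ha, AlgHom.commutes,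
      IsScalarTower.algebraMap_apply ℚ_[p] (RatFunc ℚ_[p]) L, RatFunc.algebraMap_eq_C]

lemma IsResAlgTorsionQp.exists_isStronglyStacked {p : ℕ} [Fact p.Prime] (S : PadicSetup p)
    {W : ValuationSubring (RatFunc ℚ_[p])} (hW : IsResAlgTorsionQp p W) :
    ∃ t : ℕ → Qpbar p, IsStronglyStacked p S t ∧ (W : Set (RatFunc ℚ_[p])) = ZpE p S t := by
  let L := AlgebraicClosure (RatFunc ℚ_[p])
  let ι : Qpbar p →ₐ[ℚ_[p]] L := IsAlgClosed.lift
  obtain ⟨V, hWV⟩ := W.exists_extension (L := L)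
  have hC : ∀ c : ℚ_[p], algebraMap ℚ_[p] L c = algebraMap _ L (RatFunc.C c) := fun c => by
    rw [IsScalarTower.algebraMap_apply ℚ_[p] (RatFunc ℚ_[p]) L, RatFunc.algebraMap_eq_C]
  have hV : ∀ c : ℚ_[p], algebraMap ℚ_[p] L c ∈ V ↔ ‖c‖ ≤ 1 := fun c => by
    rw [hC, hWV, hW.1]
  have h_integral : ∀ z : IsLocalRing.ResidueField W, IsIntegral ℤ z := fun z => by
    obtain ⟨k, hk, hz⟩ := hW.2.1 z
    refine ⟨X ^ p ^ k - X, monic_X_pow_sub ?_, by simp [hz]⟩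
    rw [degree_X]
    exact_mod_cast Nat.one_lt_pow (by omega) (Fact.out : p.Prime).one_lt
  set ξ : L := algebraMap (RatFunc ℚ_[p]) L RatFunc.X with hξ
  have hξtr : Transcendental ℚ_[p] ξ := by
    rw [hξ, transcendental_algebraMap_iff (algebraMap (RatFunc ℚ_[p]) L).injective]
    exact RatFunc.transcendental_X
  have hval := hW.exists_valuation_eq ι hWV
  obtain ⟨ν, hν, hνa⟩ := S.exists_isApprox ι hV (ξ := ξ)
    (fun c hc => hξtr (hc ▸ (Algebra.IsAlgebraic.isAlgebraic c).algHom ι)) hval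
    (fun x hx => ValuationSubring.exists_monic_aeval_lt_one hWV h_integral hx
      (Algebra.IsAlgebraic.isAlgebraic x))
  obtain ⟨t, ht, hmono, hcof⟩ := hν.exists_isStronglyStacked
  have htv := hν.eventually_v_sub_eq hmono hcof
  refine ⟨t, ht, ?_⟩
  have hα : ∀ c, ∃ a, V.valuation (ξ - ι c) = V.valuation (ι a) := fun c => by
    by_cases h0 : ξ - ι c = 0
    · exact ⟨0, by rw [h0, map_zero ι]⟩
    · exact (hval _ h0).imp fun _ h => h.2
  choose α hα using hα
  have hpoly : ∀ f : ℚ_[p][X], ∃ b : Qpbar p,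
      V.valuation (algebraMap _ L (algebraMap ℚ_[p][X] (RatFunc ℚ_[p]) f)) = V.valuation (ι b) ∧
      ∀ᶠ n in atTop, S.vbar.v ((f.map (algebraMap ℚ_[p] (Qpbar p))).eval (t n)) = S.vbar.v b := by
    intro f
    set F := f.map (algebraMap ℚ_[p] (Qpbar p)) with hF
    refine ⟨F.leadingCoeff * (F.roots.map α).prod, ?_, ?_⟩
    · have h1 : algebraMap _ L (algebraMap ℚ_[p][X] (RatFunc ℚ_[p]) f) =
          F.eval₂ (ι : Qpbar p →+* L) ξ := by
        rw [← RatFunc.aeval_X_left_eq_algebraMap, ← aeval_algebraMap_apply, hF, eval₂_map,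
          aeval_def, AlgHom.comp_algebraMap]
      rw [h1]
      conv_lhs => rw [(IsAlgClosed.splits F).eq_prod_roots]
      rw [eval₂_mul, eval₂_C, eval₂_multiset_prod, Multiset.map_map, map_mul, map_mul, map_mul]
      congr 1
      rw [map_multiset_prod, map_multiset_prod, map_multiset_prod, Multiset.map_map,
        Multiset.map_map, Multiset.map_map]
      congr 1
      refine Multiset.map_congr rfl fun c _ => ?_
      simpa using hα c
    · have h2 : ∀ m : Multiset (Qpbar p),
          S.vbar.v (m.map α).prod = (((m.map ν).sum : ℚ) : WithTop ℚ) := fun m => by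
        induction m using Multiset.induction_on with
        | empty => simp [S.vbar.v_one]
        | cons a m ih => simp [S.vbar.v_mul, ih, hνa a _ (hα a)]
      filter_upwards [S.vbar.v_eval_eventually_eq htv F] with n hn
      rw [hn, S.vbar.v_mul, h2]
  ext φ
  obtain ⟨a, ha, hat⟩ := hpoly φ.num
  obtain ⟨b, hb, hbt⟩ := hpoly φ.denom
  have hb0 : V.valuation (ι b) ≠ 0 := by
    rw [← hb]
    simpa using φ.denom_ne_zero
  have hbv : S.vbar.v b ≠ ⊤ := fun h => hb0 (by rw [(S.vbar.v_eq_top_iff b).1 h]; simp)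
  have h1 : φ ∈ W ↔ S.vbar.v b ≤ S.vbar.v a := by
    rw [← S.valuation_algHom_le_iff ι hV, ← ha, ← hb, ← hWV, ← V.valuation_le_one_iff]
    conv_lhs => rw [← φ.num_div_denom]
    rw [map_div₀, map_div₀, div_le_one₀ (zero_lt_iff.2 (hb ▸ hb0))]
  rw [SetLike.mem_coe, h1, mem_ZpE_iff]
  have h2 : (∀ᶠ _ in (atTop : Filter ℕ), S.vbar.v b ≠ ⊤ ∧ S.vbar.v b ≤ S.vbar.v a) ↔
      S.vbar.v b ≤ S.vbar.v a := by
    rw [eventually_const]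
    exact and_iff_right hbv
  rw [← h2]
  refine eventually_congr ?_
  filter_upwards [hat, hbt] with n h3 h4
  rw [h3, h4]

/-- Every pseudo-convergent sequence `E ⊆ Q̄_p` of transcendental type is
equivalent to a strongly stacked sequence `E'` (so that `ℤ_{p,E} = ℤ_{p,E'}`); in particular,
every residually algebraic torsion extension `W` of `ℤ_p` to `ℚ_p(X)` equals `ℤ_{p,E'}` for
some strongly stacked sequence `E' ⊆ Q̄_p`. -/
theorem stmt_3 (p : ℕ) [Fact p.Prime] (S : PadicSetup p) :
    (∀ s : ℕ → Qpbar p, S.vbar.IsPseudoConvergent s → S.vbar.IsTranscendentalType s →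
      ∃ t : ℕ → Qpbar p, IsStronglyStacked p S t ∧ S.vbar.SeqEquiv s t ∧
        ZpE p S s = ZpE p S t) ∧
    (∀ W : ValuationSubring (RatFunc ℚ_[p]), IsResAlgTorsionQp p W →
      ∃ t : ℕ → Qpbar p, IsStronglyStacked p S t ∧
        (W : Set (RatFunc ℚ_[p])) = ZpE p S t) := by
  exact ⟨fun _ hs hst => exists_isStronglyStacked_equiv S hs hst,
    fun _ hW => hW.exists_isStronglyStacked S⟩

end
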